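/- Let t ≥ 1 and let Δ(3,3,t) be the triangle group with canonical generators A, B. There is a group homomorphism ψ : Δ(3,3,t) → ℤ/3ℤ with ψ(A) = 1 and ψ(B) = 2. The kernel of ψ has index 3 in Δ(3,3,t) and equals the subgroup generated by A·B and B·A, and there is a surjective group homomorphism from Δ(t,t,t) onto this kernel sending the canonical generators X ↦ A·B and Y ↦ B·A. -/

import Mathlib

/-- The triangle group `Δ(l,m,n) = ⟨X, Y ∣ X^l = Y^m = (XY)^n = 1⟩`,
with the canonical generators the images of `0, 1 : Fin 2`. -/
def triangleRels (l m n : ℕ) : Set (FreeGroup (Fin 2)) :=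
  {FreeGroup.of 0 ^ l, FreeGroup.of 1 ^ m, (FreeGroup.of 0 * FreeGroup.of 1) ^ n}

abbrev TriangleGroup (l m n : ℕ) : Type := PresentedGroup (triangleRels l m n)

section ClosureMulMulComm

variable {G : Type*} [Group G] {a b : G}

theorem mul_self_eq_inv_of_pow_three (ha : a ^ 3 = 1) : a * a = a⁻¹ :=
  eq_inv_of_mul_eq_one_left (by rw [← pow_three', ha])

theorem conj_mem_closure_mul_mul_comm (ha : a ^ 3 = 1) (hb : b ^ 3 = 1) {h : G}
    (hh : h ∈ Subgroup.closure {a * b, b * a}) :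
    a * h * a⁻¹ ∈ Subgroup.closure {a * b, b * a} := by
  have hab : a * b ∈ Subgroup.closure {a * b, b * a} := Subgroup.subset_closure (by simp)
  have hba : b * a ∈ Subgroup.closure {a * b, b * a} := Subgroup.subset_closure (by simp)
  induction hh using Subgroup.closure_induction with
  | mem x hx =>
    rcases hx with rfl | rfl
    · have ha' : a * a = a⁻¹ := mul_self_eq_inv_of_pow_three ha
      have hb' : b⁻¹ * b⁻¹ = b := by
        rw [← mul_inv_rev, inv_eq_iff_eq_inv]
        exact mul_self_eq_inv_of_pow_three hb
      have key : a * (a * b) * a⁻¹ = (a * b * (b * a))⁻¹ := by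
        calc a * (a * b) * a⁻¹ = a * a * b * a⁻¹ := by group
          _ = a⁻¹ * (b⁻¹ * b⁻¹) * a⁻¹ := by rw [ha', hb']
          _ = (a * b * (b * a))⁻¹ := by group
      rw [key]
      exact inv_mem (mul_mem hab hba)
    · simpa [mul_assoc] using hab
  | one => simp
  | mul x y _ _ hx hy => simpa [mul_assoc] using mul_mem hx hy
  | inv x _ hx => simpa [mul_assoc] using inv_mem hx

theorem normal_closure_mul_mul_comm (ha : a ^ 3 = 1) (hb : b ^ 3 = 1)
    (hgen : Subgroup.closure {a, b} = ⊤) :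
    (Subgroup.closure {a * b, b * a}).Normal := by
  have hconj : ∀ h, h ∈ Subgroup.closure {a * b, b * a} →
      a * h * a⁻¹ ∈ Subgroup.closure {a * b, b * a} :=
    fun _ => conj_mem_closure_mul_mul_comm ha hb
  have haN : a ∈ Subgroup.normalizer (Subgroup.closure {a * b, b * a} : Set G) := by
    rw [Subgroup.mem_normalizer_iff]
    refine fun h => ⟨hconj h, fun hh => ?_⟩
    have h3 : a * (a * (a * h * a⁻¹) * a⁻¹) * a⁻¹ = h := by
      calc a * (a * (a * h * a⁻¹) * a⁻¹) * a⁻¹ = a ^ 3 * h * (a ^ 3)⁻¹ := by rw [pow_three']; group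
        _ = h := by simp [ha]
    exact h3 ▸ hconj _ (hconj _ hh)
  have hbN : b ∈ Subgroup.normalizer (Subgroup.closure {a * b, b * a} : Set G) := by
    have hab : a * b ∈ Subgroup.normalizer (Subgroup.closure {a * b, b * a} : Set G) :=
      Subgroup.le_normalizer (Subgroup.subset_closure (by simp))
    simpa using mul_mem (inv_mem haN) hab
  rw [← Subgroup.normalizer_eq_top_iff, eq_top_iff, ← hgen, Subgroup.closure_le]
  rintro x (rfl | rfl)
  exacts [haN, hbN]

theorem ker_eq_closure_mul_mul_comm (ha : a ^ 3 = 1) (hb : b ^ 3 = 1)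
    (hgen : Subgroup.closure {a, b} = ⊤) (ψ : G →* Multiplicative (ZMod 3))
    (hψa : ψ a = Multiplicative.ofAdd 1) (hψb : ψ b = Multiplicative.ofAdd 2) :
    ψ.ker = Subgroup.closure {a * b, b * a} := by
  have := normal_closure_mul_mul_comm ha hb hgen
  have hle : Subgroup.closure {a * b, b * a} ≤ ψ.ker := by
    rw [Subgroup.closure_le]
    rintro x (rfl | rfl) <;> simp only [SetLike.mem_coe, MonoidHom.mem_ker, map_mul, hψa, hψb] <;>
      decide
  refine le_antisymm (fun g hg => ?_) hle
  have hsup : Subgroup.zpowers a ⊔ Subgroup.closure {a * b, b * a} = ⊤ := by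
    have haS : a ∈ Subgroup.zpowers a ⊔ Subgroup.closure {a * b, b * a} :=
      Subgroup.mem_sup_left (Subgroup.mem_zpowers a)
    have habS : a * b ∈ Subgroup.zpowers a ⊔ Subgroup.closure {a * b, b * a} :=
      Subgroup.mem_sup_right (Subgroup.subset_closure (by simp))
    rw [eq_top_iff, ← hgen, Subgroup.closure_le]
    rintro x (rfl | rfl)
    · exact haS
    · simpa using mul_mem (inv_mem haS) habS
  obtain ⟨y, hy, h, hh, rfl⟩ := Subgroup.mem_sup_of_normal_right.1
    (hsup ▸ Subgroup.mem_top g : g ∈ Subgroup.zpowers a ⊔ Subgroup.closure {a * b, b * a})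
  obtain ⟨k, rfl⟩ := Subgroup.mem_zpowers_iff.1 hy
  have hk : ((k : ℤ) : ZMod 3) = 0 := by
    have h1 : ψ (a ^ k * h) = 1 := hg
    rw [map_mul, MonoidHom.mem_ker.1 (hle hh), mul_one, map_zpow, hψa, ← ofAdd_zsmul,
      ofAdd_eq_one] at h1
    simpa using h1
  obtain ⟨m, rfl⟩ := (ZMod.intCast_zmod_eq_zero_iff_dvd k 3).1 hk
  have h3 : a ^ (((3 : ℕ) : ℤ) * m) = 1 := by rw [zpow_mul, zpow_natCast, ha, one_zpow]
  rwa [h3, one_mul]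

theorem mul_mul_mul_comm_pow_eq_one (ha : a ^ 3 = 1) (hb : b ^ 3 = 1) {t : ℕ}
    (hab : (a * b) ^ t = 1) : (a * b * (b * a)) ^ t = 1 := by
  have ha' : a * a = a⁻¹ := mul_self_eq_inv_of_pow_three ha
  have hb' : b * b = b⁻¹ := mul_self_eq_inv_of_pow_three hb
  have key : a * b * (b * a) = (a * a)⁻¹ * (a * b)⁻¹ * (a * a)⁻¹⁻¹ := by
    calc a * b * (b * a) = a * (b * b) * a⁻¹ * (a * a) := by group
      _ = (a * a)⁻¹ * (a * b)⁻¹ * (a * a)⁻¹⁻¹ := by rw [hb', ha']; group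
  rw [key, conj_pow, inv_pow, hab]
  simp

theorem pow_mul_comm_eq_one {t : ℕ} (hab : (a * b) ^ t = 1) : (b * a) ^ t = 1 := by
  have key : b * a = a⁻¹ * (a * b) * a⁻¹⁻¹ := by group
  rw [key, conj_pow, hab]
  simp

end ClosureMulMulComm

namespace TriangleGroup

/-- The homomorphism out of a triangle group determined by the images of the generators. -/
def lift {G : Type*} [Group G] {l m n : ℕ} (x y : G) (hx : x ^ l = 1) (hy : y ^ m = 1)
    (hxy : (x * y) ^ n = 1) : TriangleGroup l m n →* G :=
  PresentedGroup.toGroup (f := ![x, y]) (by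
    rintro r (rfl | rfl | rfl) <;> simpa)

section Lift

variable {G : Type*} [Group G] {l m n : ℕ} {x y : G} (hx : x ^ l = 1) (hy : y ^ m = 1)
  (hxy : (x * y) ^ n = 1)

@[simp]
theorem lift_of_zero : lift x y hx hy hxy (PresentedGroup.of 0) = x := by
  simp [lift]

@[simp]
theorem lift_of_one : lift x y hx hy hxy (PresentedGroup.of 1) = y := by
  simp [lift]

end Lift

variable (l m n : ℕ)

theorem of_zero_pow : (PresentedGroup.of 0 : TriangleGroup l m n) ^ l = 1 :=
  PresentedGroup.one_of_mem (rels := triangleRels l m n) (x := FreeGroup.of 0 ^ l)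
    (by simp [triangleRels])

theorem of_one_pow : (PresentedGroup.of 1 : TriangleGroup l m n) ^ m = 1 :=
  PresentedGroup.one_of_mem (rels := triangleRels l m n) (x := FreeGroup.of 1 ^ m)
    (by simp [triangleRels])

theorem of_zero_mul_of_one_pow :
    (PresentedGroup.of 0 * PresentedGroup.of 1 : TriangleGroup l m n) ^ n = 1 :=
  PresentedGroup.one_of_mem (rels := triangleRels l m n)
    (x := (FreeGroup.of 0 * FreeGroup.of 1) ^ n) (by simp [triangleRels])

theorem closure_generators :
    Subgroup.closure {(PresentedGroup.of 0 : TriangleGroup l m n), PresentedGroup.of 1} = ⊤ := by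
  rw [← PresentedGroup.closure_range_of (triangleRels l m n)]
  congr 1
  ext x
  simp [Fin.exists_fin_two, eq_comm]

end TriangleGroup

/-- There is a homomorphism `ψ : Δ(3,3,t) → ℤ/3ℤ` with `ψ A = 1`, `ψ B = 2`
(`A, B` the canonical generators); its kernel has index `3`, equals the subgroup
generated by `AB` and `BA`, and is a surjective image of `Δ(t,t,t)` via
`X ↦ AB`, `Y ↦ BA`. -/
theorem stmt_13 (t : ℕ) (ht : 1 ≤ t) :
    ∃ ψ : TriangleGroup 3 3 t →* Multiplicative (ZMod 3),
      ψ (PresentedGroup.of 0) = Multiplicative.ofAdd (1 : ZMod 3) ∧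
      ψ (PresentedGroup.of 1) = Multiplicative.ofAdd (2 : ZMod 3) ∧
      ψ.ker.index = 3 ∧
      ψ.ker = Subgroup.closure
        {PresentedGroup.of 0 * PresentedGroup.of 1,
         PresentedGroup.of 1 * PresentedGroup.of 0} ∧
      ∃ f : TriangleGroup t t t →* TriangleGroup 3 3 t,
        f (PresentedGroup.of 0) = PresentedGroup.of 0 * PresentedGroup.of 1 ∧
        f (PresentedGroup.of 1) = PresentedGroup.of 1 * PresentedGroup.of 0 ∧
        f.range = ψ.ker := by
  have hA := TriangleGroup.of_zero_pow 3 3 t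
  have hB := TriangleGroup.of_one_pow 3 3 t
  have hAB := TriangleGroup.of_zero_mul_of_one_pow 3 3 t
  have hBA : (PresentedGroup.of 1 * PresentedGroup.of 0 : TriangleGroup 3 3 t) ^ t = 1 :=
    pow_mul_comm_eq_one hAB
  let ψ : TriangleGroup 3 3 t →* Multiplicative (ZMod 3) :=
    TriangleGroup.lift (Multiplicative.ofAdd 1) (Multiplicative.ofAdd 2) (by decide) (by decide)
      (by rw [show (Multiplicative.ofAdd 1 * Multiplicative.ofAdd 2 : Multiplicative (ZMod 3)) = 1
        by decide, one_pow])
  have hψA : ψ (PresentedGroup.of 0) = Multiplicative.ofAdd 1 := TriangleGroup.lift_of_zero ..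
  have hψB : ψ (PresentedGroup.of 1) = Multiplicative.ofAdd 2 := TriangleGroup.lift_of_one ..
  have hker := ker_eq_closure_mul_mul_comm hA hB
    (TriangleGroup.closure_generators 3 3 t) ψ hψA hψB
  have hsurj : Function.Surjective ψ := fun z => by
    refine ⟨PresentedGroup.of 0 ^ z.toAdd.val, ?_⟩
    rw [map_pow, hψA, ← ofAdd_nsmul]
    simp
  refine ⟨ψ, hψA, hψB, ?_, hker,
    TriangleGroup.lift _ _ hAB hBA (mul_mul_mul_comm_pow_eq_one hA hB hAB),
    TriangleGroup.lift_of_zero .., TriangleGroup.lift_of_one .., ?_⟩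
  · rw [Subgroup.index_ker, MonoidHom.range_eq_top.2 hsurj]
    simp
  · rw [hker, MonoidHom.range_eq_map, ← TriangleGroup.closure_generators, MonoidHom.map_closure,
      Set.image_pair, TriangleGroup.lift_of_zero, TriangleGroup.lift_of_one]
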